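/- Let V(ρ) = 2(1−6ρ²+ρ⁴)/(1+ρ²)². There is no function u : [0,1] → ℂ that is continuous on [0,1], twice continuously differentiable on (0,1), satisfies u(0) = 0, and solves −(1−ρ²)u''(ρ) − (2(1−ρ²)/ρ)u'(ρ) + 2ρu'(ρ) + 2u(ρ) + (V(ρ)/ρ²)u(ρ) = ρ(5+ρ²)/(1+ρ²)² for all ρ ∈ (0,1). -/

import Mathlib

/-- The potential `V(ρ) = 2(1−6ρ²+ρ⁴)/(1+ρ²)²`. -/
noncomputable def Vpot (ρ : ℝ) : ℝ := 2 * (1 - 6 * ρ ^ 2 + ρ ^ 4) / (1 + ρ ^ 2) ^ 2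

/-- Real core: the weighted Wronskian with the gauge mode is strictly decreasing, which forces
blow-up at one of the end points. -/
theorem real_core (f g g2 : ℝ → ℝ) (M : ℝ)
    (hf : ∀ x ∈ Set.Ioo (0:ℝ) 1, HasDerivAt f (g x) x)
    (hg : ∀ x ∈ Set.Ioo (0:ℝ) 1, HasDerivAt g (g2 x) x)
    (hM : ∀ x ∈ Set.Ioo (0:ℝ) 1, |f x| ≤ M)
    (ode : ∀ x ∈ Set.Ioo (0:ℝ) 1,
      -(1 - x ^ 2) * g2 x - (2 * (1 - x ^ 2) / x) * g x + 2 * x * g x + 2 * f x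
        + (Vpot x / x ^ 2) * f x = x * (5 + x ^ 2) / (1 + x ^ 2) ^ 2) : False := by
  obtain ⟨W, hW⟩ : ∃ W : ℝ → ℝ, W = fun x => x ^ 3 * (1 - x ^ 2) / (1 + x ^ 2) * g x
      - x ^ 2 * (1 - x ^ 2) ^ 2 / (1 + x ^ 2) ^ 2 * f x := ⟨_, rfl⟩
  have hWd : ∀ x ∈ Set.Ioo (0:ℝ) 1,
      HasDerivAt W (-(x ^ 4 * (5 + x ^ 2) / (1 + x ^ 2) ^ 3)) x := by
    intro x hx
    have hx0 : x ≠ 0 := hx.1.ne'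
    have hp : (1 + x ^ 2) ≠ 0 := by positivity
    have hp2 : (1 + x ^ 2) ^ 2 ≠ 0 := by positivity
    have hi := hasDerivAt_id' x
    have hq : HasDerivAt (fun y : ℝ => 1 + y ^ 2) _ x := (hi.pow 2).const_add 1
    have hm : HasDerivAt (fun y : ℝ => 1 - y ^ 2) _ x := (hi.pow 2).const_sub 1
    have h := ((((hi.pow 3).mul hm).div hq hp).mul (hg x hx)).sub
      (((((hi.pow 2).mul (hm.pow 2))).div (hq.pow 2) hp2).mul (hf x hx))
    rw [hW]
    refine h.congr_deriv ?_
    have e := ode x hx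
    unfold Vpot at e
    simp only [Pi.mul_apply, Pi.pow_apply, Pi.div_apply]
    field_simp at e ⊢
    push_cast
    simp only [Nat.add_one_sub_one, Nat.reduceSub, pow_one]
    linear_combination (-x * (1 + x ^ 2)) * e
  have hanti : StrictAntiOn W (Set.Ioo 0 1) := by
    apply strictAntiOn_of_deriv_neg (convex_Ioo 0 1)
    · intro x hx
      exact (hWd x hx).continuousAt.continuousWithinAt
    · intro x hx
      rw [interior_Ioo] at hx
      rw [(hWd x hx).deriv]
      have := hx.1
      have : 0 < x ^ 4 * (5 + x ^ 2) / (1 + x ^ 2) ^ 3 := by positivity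
      linarith
  obtain ⟨v, hv⟩ : ∃ v : ℝ → ℝ, v = fun x => f x * ((1 + x ^ 2) / x) := ⟨_, rfl⟩
  have hvd : ∀ x ∈ Set.Ioo (0:ℝ) 1,
      HasDerivAt v (W x * (1 + x ^ 2) ^ 2 / (x ^ 4 * (1 - x ^ 2))) x := by
    intro x hx
    have hx0 : x ≠ 0 := hx.1.ne'
    have hp : (1 + x ^ 2) ≠ 0 := by positivity
    have hm0 : (1 - x ^ 2) ≠ 0 := by nlinarith [hx.1, hx.2]
    have hi := hasDerivAt_id' x
    have hq : HasDerivAt (fun y : ℝ => 1 + y ^ 2) _ x := (hi.pow 2).const_add 1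
    have h := (hf x hx).mul (hq.div hi hx0)
    rw [hv]
    refine h.congr_deriv ?_
    rw [hW]
    simp only [Pi.div_apply]
    field_simp
    push_cast
    simp only [Nat.add_one_sub_one, Nat.reduceSub, pow_one]
    ring
  have hvb : ∀ x ∈ Set.Ioo (0:ℝ) 1, x * |v x| ≤ 2 * M := by
    intro x hx
    have hx0 := hx.1
    have h1 : x * |v x| = |f x| * (1 + x ^ 2) := by
      rw [hv]
      simp only [abs_mul, abs_div, abs_of_pos hx0, abs_of_pos (show 0 < 1 + x ^ 2 by positivity)]
      field_simp
    rw [h1]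
    have hx2 : x ^ 2 ≤ 1 := by nlinarith [hx.2]
    nlinarith [hM x hx, abs_nonneg (f x)]
  have hhalf : (1/2:ℝ) ∈ Set.Ioo (0:ℝ) 1 := by constructor <;> norm_num
  have hM0 : 0 ≤ M := (abs_nonneg _).trans (hM _ hhalf)
  by_cases hneg : ∃ a ∈ Set.Ioo (0:ℝ) 1, W a < 0
  · obtain ⟨a, ha, hWa⟩ := hneg
    obtain ⟨k, hk⟩ : ∃ k, k = -W a / 2 := ⟨_, rfl⟩
    have hkpos : 0 < k := by rw [hk]; linarith
    have hder : ∀ x ∈ Set.Ico a 1, HasDerivAt (fun y => v y - k * Real.log (1 - y))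
        (W x * (1 + x ^ 2) ^ 2 / (x ^ 4 * (1 - x ^ 2)) - k * (-1 / (1 - x))) x := by
      intro x hx
      have hx' : x ∈ Set.Ioo (0:ℝ) 1 := ⟨ha.1.trans_le hx.1, hx.2⟩
      exact (hvd x hx').sub ((((hasDerivAt_id' x).const_sub 1).log
        (by linarith [hx.2])).const_mul k)
    have hA : AntitoneOn (fun y => v y - k * Real.log (1 - y)) (Set.Ico a 1) := by
      apply antitoneOn_of_deriv_nonpos (convex_Ico a 1)
      · intro x hx
        exact (hder x hx).continuousAt.continuousWithinAt
      · intro x hx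
        exact (hder x (interior_subset hx)).differentiableAt.differentiableWithinAt
      · intro x hx
        have hx2 := interior_subset hx
        rw [(hder x hx2).deriv]
        have hx' : x ∈ Set.Ioo (0:ℝ) 1 := ⟨ha.1.trans_le hx2.1, hx2.2⟩
        have hWx : W x ≤ W a := hanti.antitoneOn ha hx' hx2.1
        have hx0 := hx'.1
        have h1x : 0 < 1 - x := by linarith [hx'.2]
        have hfac : 1 - x ^ 2 = (1 - x) * (1 + x) := by ring
        have hr : 1 / 2 ≤ (1 + x ^ 2) ^ 2 / (x ^ 4 * (1 + x)) := by
          rw [div_le_div_iff₀ (by norm_num) (by positivity)]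
          have : x ^ 4 * (1 + x) ≤ x ^ 4 * 2 := by
            apply mul_le_mul_of_nonneg_left (by linarith) (by positivity)
          nlinarith [sq_nonneg x]
        have e : W x * (1 + x ^ 2) ^ 2 / (x ^ 4 * (1 - x ^ 2)) - k * (-1 / (1 - x))
            = (W x * ((1 + x ^ 2) ^ 2 / (x ^ 4 * (1 + x))) + k) / (1 - x) := by
          rw [hfac]; field_simp; ring
        rw [e]
        apply div_nonpos_of_nonpos_of_nonneg _ h1x.le
        rw [hk]
        nlinarith
    -- v x ≥ -2M/a on [a,1), choose x near 1
    obtain ⟨C, hC⟩ : ∃ C, C = v a - k * Real.log (1 - a) := ⟨_, rfl⟩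
    obtain ⟨L, hL⟩ : ∃ L, L = (-(2 * M / a) - C - 1) / k := ⟨_, rfl⟩
    obtain ⟨x, hx⟩ : ∃ x, x = max a (1 - Real.exp L) := ⟨_, rfl⟩
    have hxa : a ≤ x := hx ▸ le_max_left _ _
    have hx1 : x < 1 := by rw [hx]; exact max_lt ha.2 (by linarith [Real.exp_pos L])
    have hx2 : 1 - x ≤ Real.exp L := by
      have : 1 - Real.exp L ≤ x := hx ▸ le_max_right _ _
      linarith
    have hlog : Real.log (1 - x) ≤ L := by
      rw [Real.log_le_iff_le_exp (by linarith)]; exact hx2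
    have h1 := hA ⟨le_rfl, ha.2⟩ ⟨hxa, hx1⟩ hxa
    simp only [← hC] at h1
    have h2 := hvb x ⟨ha.1.trans_le hxa, hx1⟩
    have h3 : |v x| ≤ 2 * M / a := by
      rw [le_div_iff₀ ha.1]
      nlinarith [abs_nonneg (v x)]
    have h4 := neg_abs_le (v x)
    have h5 : k * Real.log (1 - x) ≤ k * L := mul_le_mul_of_nonneg_left hlog hkpos.le
    have h6 : k * L = -(2 * M / a) - C - 1 := by rw [hL]; field_simp
    linarith
  · push Not at hneg
    have hw : 0 < W (1/2) := by
      have h34 : (3/4:ℝ) ∈ Set.Ioo (0:ℝ) 1 := by constructor <;> norm_num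
      exact (hneg _ h34).trans_lt (hanti hhalf h34 (by norm_num))
    obtain ⟨w, hwe⟩ : ∃ w, w = W (1/2) := ⟨_, rfl⟩
    rw [← hwe] at hw
    -- v + w / (2 x^2) is increasing on (0,1/2]
    have hder : ∀ x ∈ Set.Ioc (0:ℝ) (1/2), HasDerivAt (fun y => v y + w / 2 * (y ^ 2)⁻¹)
        (W x * (1 + x ^ 2) ^ 2 / (x ^ 4 * (1 - x ^ 2)) - w / x ^ 3) x := by
      intro x hx
      have hx0 : x ≠ 0 := hx.1.ne'
      have hx' : x ∈ Set.Ioo (0:ℝ) 1 := ⟨hx.1, by linarith [hx.2]⟩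
      have h := (hvd x hx').add
        ((((hasDerivAt_id' x).pow 2).inv (by simpa using hx0)).const_mul (w / 2))
      refine h.congr_deriv ?_
      rw [sub_eq_add_neg]
      congr 1
      simp only [Pi.pow_apply]
      field_simp
      push_cast
      ring
    have hA : MonotoneOn (fun y => v y + w / 2 * (y ^ 2)⁻¹) (Set.Ioc 0 (1/2)) := by
      apply monotoneOn_of_deriv_nonneg (convex_Ioc _ _)
      · intro x hx
        exact (hder x hx).continuousAt.continuousWithinAt
      · intro x hx
        exact (hder x (interior_subset hx)).differentiableAt.differentiableWithinAt
      · intro x hx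
        have hx2 := interior_subset hx
        rw [(hder x hx2).deriv]
        have hx' : x ∈ Set.Ioo (0:ℝ) 1 := ⟨hx2.1, by linarith [hx2.2]⟩
        have hWx : w ≤ W x := hwe ▸ hanti.antitoneOn hx' hhalf hx2.2
        have hx0 := hx'.1
        have hm : 0 < 1 - x ^ 2 := by nlinarith [hx'.2]
        have hr : 1 ≤ (1 + x ^ 2) ^ 2 / (x * (1 - x ^ 2)) := by
          rw [le_div_iff₀ (by positivity)]
          have : x * (1 - x ^ 2) ≤ 1 := by nlinarith [hx'.2, pow_pos hx0 3]
          nlinarith [sq_nonneg x, sq_nonneg (x ^ 2)]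
        have e : W x * (1 + x ^ 2) ^ 2 / (x ^ 4 * (1 - x ^ 2)) - w / x ^ 3
            = (W x * ((1 + x ^ 2) ^ 2 / (x * (1 - x ^ 2))) - w) / x ^ 3 := by
          field_simp
        rw [e]
        apply div_nonneg _ (by positivity)
        nlinarith
    obtain ⟨C, hC⟩ : ∃ C, C = |v (1/2) + w / 2 * ((1/2) ^ 2)⁻¹| := ⟨_, rfl⟩
    have hC0 : 0 ≤ C := hC ▸ abs_nonneg _
    obtain ⟨x, hx⟩ : ∃ x, x = min (1/2) (w / (4 * (2 * M + C + 1))) := ⟨_, rfl⟩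
    have hD : 0 < 4 * (2 * M + C + 1) := by positivity
    have hx0 : 0 < x := by rw [hx]; exact lt_min (by norm_num) (by positivity)
    have hxh : x ≤ 1/2 := hx ▸ min_le_left _ _
    have hxw : x * (4 * (2 * M + C + 1)) ≤ w := by
      rw [← le_div_iff₀ hD]; exact hx ▸ min_le_right _ _
    have h1 := hA ⟨hx0, hxh⟩ ⟨by norm_num, le_rfl⟩ hxh
    have h1' : v x + w / 2 * (x ^ 2)⁻¹ ≤ C := h1.trans (hC ▸ le_abs_self _)
    have h2 := hvb x ⟨hx0, by linarith⟩
    have h3 := neg_abs_le (v x)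
    have h4 : x ^ 2 * (v x + w / 2 * (x ^ 2)⁻¹) = x ^ 2 * v x + w / 2 := by field_simp
    have h5 : x ^ 2 * v x + w / 2 ≤ x ^ 2 * C := by
      rw [← h4]; exact mul_le_mul_of_nonneg_left h1' (by positivity)
    have h6 : -(x * (2 * M)) ≤ x ^ 2 * v x := by nlinarith
    have h7 : x ^ 2 * C ≤ x * C := by
      apply mul_le_mul_of_nonneg_right _ hC0
      nlinarith
    nlinarith

/-- there is no `u : [0,1] → ℂ`, continuous on `[0,1]`, twice continuously
differentiable on `(0,1)`, with `u(0) = 0`, solving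
`−(1−ρ²)u'' − (2(1−ρ²)/ρ)u' + 2ρu' + 2u + (V(ρ)/ρ²)u = ρ(5+ρ²)/(1+ρ²)²` on `(0,1)`. -/
theorem stmt_19 :
    ¬ ∃ u : ℝ → ℂ,
      ContinuousOn u (Set.Icc 0 1) ∧
      ContDiffOn ℝ 2 u (Set.Ioo 0 1) ∧
      u 0 = 0 ∧
      ∀ ρ ∈ Set.Ioo (0:ℝ) 1,
        -(1 - (ρ:ℂ) ^ 2) * deriv (deriv u) ρ
        - (2 * (1 - (ρ:ℂ) ^ 2) / (ρ:ℂ)) * deriv u ρ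
        + 2 * (ρ:ℂ) * deriv u ρ
        + 2 * u ρ
        + (((Vpot ρ : ℝ) : ℂ) / (ρ:ℂ) ^ 2) * u ρ
        = ((ρ * (5 + ρ ^ 2) / (1 + ρ ^ 2) ^ 2 : ℝ) : ℂ) := by

  rintro ⟨u, hc, hd, -, ode⟩
  obtain ⟨M, hM⟩ := isCompact_Icc.exists_bound_of_continuousOn hc
  have hd1 : ∀ x ∈ Set.Ioo (0:ℝ) 1, HasDerivAt u (deriv u x) x := fun x hx =>
    ((hd.contDiffAt (isOpen_Ioo.mem_nhds hx)).differentiableAt (by norm_num)).hasDerivAt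
  have hdd : ContDiffOn ℝ 1 (deriv u) (Set.Ioo 0 1) :=
    hd.deriv_of_isOpen isOpen_Ioo (by norm_num)
  have hd2 : ∀ x ∈ Set.Ioo (0:ℝ) 1, HasDerivAt (deriv u) (deriv (deriv u) x) x := fun x hx =>
    ((hdd.contDiffAt (isOpen_Ioo.mem_nhds hx)).differentiableAt (by norm_num)).hasDerivAt
  refine real_core (fun x => (u x).re) (fun x => (deriv u x).re)
    (fun x => (deriv (deriv u) x).re) M ?_ ?_ ?_ ?_
  · intro x hx
    exact Complex.reCLM.hasFDerivAt.comp_hasDerivAt x (hd1 x hx)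
  · intro x hx
    exact Complex.reCLM.hasFDerivAt.comp_hasDerivAt x (hd2 x hx)
  · intro x hx
    exact (Complex.abs_re_le_norm _).trans (hM x ⟨hx.1.le, hx.2.le⟩)
  · intro x hx
    have e := ode x hx
    have e1 : (((-(1 - x ^ 2) : ℝ) : ℂ)) * deriv (deriv u) x
        - ((2 * (1 - x ^ 2) / x : ℝ) : ℂ) * deriv u x + ((2 * x : ℝ) : ℂ) * deriv u x
        + ((2 : ℝ) : ℂ) * u x + ((Vpot x / x ^ 2 : ℝ) : ℂ) * u x
        = ((x * (5 + x ^ 2) / (1 + x ^ 2) ^ 2 : ℝ) : ℂ) := by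
      rw [← e]; push_cast; ring
    have e2 := congrArg Complex.re e1
    simpa only [Complex.add_re, Complex.sub_re, Complex.re_ofReal_mul, Complex.ofReal_re] using e2
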